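/- Fix an integer r ≥ 2 and a constant α > 0, and for real n > 0 and real x define Q_r(n,x) = Σ_{i=1}^{r} C(x,i)·C(n−x, r+1−i), where C(y,j) = y(y−1)···(y−j+1)/j! denotes the polynomial extension of the binomial coefficient, and define q_r(n,x) = r/x − α·r·Q_r(n,x)/(n^r·x). Then: (i) for all sufficiently large n, the maximum of x ↦ q_r(n,x) over the interval [r+1, n/2] is attained at x = r+1 or at x = n/2; and (ii) if α > r!/(r+1), then there exist constants ε > 0, C > 0 and N such that for all n ≥ N and all x ∈ [r+1, n/2], q_r(n,x) ≤ −ε + C/n (in particular q_r(n,x) < 0 for all sufficiently large n). -/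

import Mathlib

/-- The polynomial (falling-factorial) extension of the binomial coefficient to real
arguments: `realChoose y j = y(y-1)⋯(y-j+1)/j!`. -/
noncomputable def realChoose (y : ℝ) (j : ℕ) : ℝ :=
  (descPochhammer ℝ j).eval y / (Nat.factorial j : ℝ)

/-- `Qr r n x = ∑_{i=1}^r C(x,i)·C(n−x, r+1−i)` as a real function. -/
noncomputable def Qr (r : ℕ) (n x : ℝ) : ℝ :=
  ∑ i ∈ Finset.Icc 1 r, realChoose x i * realChoose (n - x) (r + 1 - i)

/-- `qr r α n x = r/x − α·r·Qr(n,x)/(n^r·x)`. -/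
noncomputable def qr (r : ℕ) (α : ℝ) (n x : ℝ) : ℝ :=
  (r : ℝ) / x - α * r * Qr r n x / ((n : ℝ) ^ r * x)

open Filter Topology

theorem realChoose_eq_ringChoose (y : ℝ) (j : ℕ) : realChoose y j = Ring.choose y j := by
  rw [realChoose, Ring.choose_eq_smul, Polynomial.descPochhammer_smeval_eq_ascPochhammer,
    Polynomial.ascPochhammer_smeval_eq_eval, descPochhammer_eval_eq_ascPochhammer, smul_eq_mul,
    div_eq_inv_mul]

theorem realChoose_nonneg {y : ℝ} {j : ℕ} (h : (j : ℝ) - 1 ≤ y) : 0 ≤ realChoose y j :=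
  div_nonneg (descPochhammer_nonneg h) (Nat.cast_nonneg _)

theorem realChoose_one (y : ℝ) : realChoose y 1 = y := by
  simp [realChoose]

theorem convexOn_realChoose (j : ℕ) :
    ConvexOn ℝ (Set.Ici ((j : ℝ) - 1)) (fun y => realChoose y j) := by
  have h := (convexOn_descPochhammer_eval j).smul
    (inv_nonneg.2 (Nat.cast_nonneg (α := ℝ) j.factorial))
  refine h.congr fun y _ => ?_
  simp [realChoose, div_eq_inv_mul]

/-- Chu-Vandermonde: `Qr` is the full convolution minus its two extreme terms. -/
theorem Qr_eq (r : ℕ) (n x : ℝ) :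
    Qr r n x = realChoose n (r + 1) - realChoose x (r + 1) - realChoose (n - x) (r + 1) := by
  have h := Ring.add_choose_eq (r := x) (s := n - x) (r + 1) (Commute.all _ _)
  rw [Finset.Nat.sum_antidiagonal_eq_sum_range_succ_mk, Finset.sum_range_succ,
    Finset.sum_range_succ', add_sub_cancel] at h
  have hQ : Qr r n x = ∑ k ∈ Finset.range r,
      Ring.choose x (k + 1) * Ring.choose (n - x) (r + 1 - (k + 1)) := by
    simp only [Qr, realChoose_eq_ringChoose]
    rw [Finset.range_eq_Ico, Finset.sum_Ico_add' (fun i => Ring.choose x i *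
      Ring.choose (n - x) (r + 1 - i)) 0 r 1]
    rfl
  simp only [realChoose_eq_ringChoose, h, hQ]
  simp

theorem concaveOn_Qr (r : ℕ) (n : ℝ) : ConcaveOn ℝ (Set.Icc (r : ℝ) (n - r)) (Qr r n) := by
  have h1 : ConvexOn ℝ (Set.Icc (r : ℝ) (n - r)) (fun x => realChoose x (r + 1)) :=
    (convexOn_realChoose (r + 1)).subset (fun x hx => by simpa using hx.1) (convex_Icc _ _)
  have h2 : ConvexOn ℝ (Set.Icc (r : ℝ) (n - r)) (fun x => realChoose (n - x) (r + 1)) := by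
    have h := (convexOn_realChoose (r + 1)).comp_affineMap (AffineMap.lineMap n (n - 1))
    refine (h.subset (fun x hx => ?_) (convex_Icc _ _)).congr fun x _ => ?_
    · have := hx.2
      simp only [Set.mem_preimage, AffineMap.lineMap_apply_ring', Set.mem_Ici]
      push_cast
      linarith
    · simp only [Function.comp_apply, AffineMap.lineMap_apply_ring']
      congr 1
      ring
  have h := (concaveOn_const (realChoose n (r + 1)) (convex_Icc (r : ℝ) (n - r))).sub (h1.add h2)
  refine h.congr fun x _ => ?_
  simp only [Qr_eq, Pi.sub_apply, Pi.add_apply]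
  ring

theorem ConvexOn.div_id_le_max {s : Set ℝ} {G : ℝ → ℝ} (hG : ConvexOn ℝ s G) {a b x : ℝ}
    (ha : a ∈ s) (hb : b ∈ s) (ha0 : 0 < a) (hx : x ∈ Set.Icc a b) :
    G x / x ≤ max (G a / a) (G b / b) := by
  have hab : a ≤ b := hx.1.trans hx.2
  have hx0 : 0 < x := ha0.trans_le hx.1
  set M := max (G a / a) (G b / b)
  have hGa : G a ≤ M * a := (div_le_iff₀ ha0).1 (le_max_left _ _)
  have hGb : G b ≤ M * b := (div_le_iff₀ (ha0.trans_le hab)).1 (le_max_right _ _)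
  rw [← segment_eq_Icc hab] at hx
  obtain ⟨u, v, hu, hv, huv, rfl⟩ := hx
  rw [div_le_iff₀ hx0]
  have h := hG.2 ha hb hu hv huv
  simp only [smul_eq_mul] at h ⊢
  nlinarith [mul_le_mul_of_nonneg_left hGa hu, mul_le_mul_of_nonneg_left hGb hv]

theorem qr_le_max {r : ℕ} {α n x : ℝ} (hα : 0 ≤ α)
    (hx : x ∈ Set.Icc ((r : ℝ) + 1) (n / 2)) :
    qr r α n x ≤ max (qr r α n ((r : ℝ) + 1)) (qr r α n (n / 2)) := by
  have hr : (0 : ℝ) ≤ r := Nat.cast_nonneg r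
  have hn : (r : ℝ) + 1 ≤ n / 2 := hx.1.trans hx.2
  have hn0 : 0 < n := by linarith
  have hG : ConvexOn ℝ (Set.Icc (r : ℝ) (n - r))
      (fun y => (r : ℝ) - α * r / n ^ r * Qr r n y) :=
    (convexOn_const (r : ℝ) (convex_Icc _ _)).sub
      ((concaveOn_Qr r n).smul (c := α * r / n ^ r) (by positivity))
  have hq : ∀ y, qr r α n y = ((r : ℝ) - α * r / n ^ r * Qr r n y) / y := fun y => by
    rw [qr, sub_div, div_mul_eq_mul_div, div_div]
  simp only [hq]
  exact hG.div_id_le_max (a := r + 1) (b := n / 2) ⟨by linarith, by linarith⟩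
    ⟨by linarith, by linarith⟩ (by linarith) hx

theorem mul_realChoose_le_Qr {r : ℕ} (hr : 1 ≤ r) {n x : ℝ} (hx : (r : ℝ) ≤ x)
    (hxn : x ≤ n - r) : x * realChoose (n - x) r ≤ Qr r n x := by
  have h := Finset.single_le_sum
    (f := fun i => realChoose x i * realChoose (n - x) (r + 1 - i)) (s := Finset.Icc 1 r)
    (fun i hi => ?_) (Finset.mem_Icc.2 ⟨le_rfl, hr⟩)
  · simpa [Qr, realChoose_one] using h
  · obtain ⟨h1, h2⟩ := Finset.mem_Icc.1 hi
    have h2' : (i : ℝ) ≤ r := by exact_mod_cast h2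
    have h3 : ((r + 1 - i : ℕ) : ℝ) ≤ r := by exact_mod_cast (by omega : r + 1 - i ≤ r)
    exact mul_nonneg (realChoose_nonneg (by linarith)) (realChoose_nonneg (by linarith))

theorem qr_le {r : ℕ} (hr : 1 ≤ r) {α n x : ℝ} (hα : 0 ≤ α) (hx : (r : ℝ) ≤ x)
    (hxn : x ≤ n - r) :
    qr r α n x ≤ r / x - α * r * (realChoose (n - x) r / n ^ r) := by
  have hr0 : (0 : ℝ) < r := by exact_mod_cast hr
  have hx0 : 0 < x := hr0.trans_le hx
  have hn0 : 0 < n := by linarith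
  have h := mul_realChoose_le_Qr hr hx hxn
  have h' : α * r * (realChoose (n - x) r / n ^ r) =
      α * r * (x * realChoose (n - x) r) / (n ^ r * x) := by
    field_simp
  rw [qr, h']
  gcongr

theorem tendsto_realChoose_linear_div_pow (a b : ℝ) (j : ℕ) :
    Tendsto (fun n : ℝ => realChoose (a * n + b) j / n ^ j) atTop (𝓝 (a ^ j / j.factorial)) := by
  have key : Tendsto (fun n : ℝ => (descPochhammer ℝ j).eval (a * n + b) / n ^ j) atTop
      (𝓝 (a ^ j)) := by
    induction j with
    | zero => simp
    | succ j ih =>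
      have h1 : Tendsto (fun n : ℝ => a + (b - j) / n) atTop (𝓝 (a + 0)) :=
        tendsto_const_nhds.add (tendsto_const_nhds.div_atTop tendsto_id)
      rw [add_zero] at h1
      rw [pow_succ]
      refine (ih.mul h1).congr' ?_
      filter_upwards [eventually_gt_atTop 0] with n hn
      rw [descPochhammer_succ_eval]
      field_simp
      ring
  refine (key.div_const _).congr fun n => ?_
  rw [realChoose, div_right_comm]

/-- Technical lemma: (i) for all sufficiently large n, the maximum of `qr r α n` over the
interval [r+1, n/2] is attained at one of the endpoints; (ii) if α > r!/(r+1) then there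
are constants ε > 0, C > 0 and N such that for all n ≥ N and all x ∈ [r+1, n/2],
`qr r α n x ≤ −ε + C/n` (in particular `qr r α n x < 0` for all sufficiently large n). -/
theorem stmt18 (r : ℕ) (hr : 2 ≤ r) (α : ℝ) (hα : 0 < α) :
    (∃ N : ℝ, ∀ n : ℝ, N ≤ n → ∀ x ∈ Set.Icc ((r : ℝ) + 1) (n / 2),
        qr r α n x ≤ max (qr r α n ((r : ℝ) + 1)) (qr r α n (n / 2))) ∧
    ((Nat.factorial r : ℝ) / (r + 1) < α →
      ∃ ε : ℝ, 0 < ε ∧ ∃ C : ℝ, 0 < C ∧ ∃ N : ℝ, 0 < N ∧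
        ∀ n : ℝ, N ≤ n → ∀ x ∈ Set.Icc ((r : ℝ) + 1) (n / 2),
          qr r α n x ≤ -ε + C / n) := by
  refine ⟨⟨0, fun n _ x hx => qr_le_max hα.le hx⟩, fun hαr => ?_⟩
  have hr1 : 1 ≤ r := by omega
  have hr0 : (0 : ℝ) < r := by exact_mod_cast hr1
  have hf : (0 : ℝ) < r.factorial := by exact_mod_cast r.factorial_pos
  have hleft : Tendsto (fun n : ℝ => r / ((r : ℝ) + 1) -
      α * r * (realChoose (n - (r + 1)) r / n ^ r)) atTop
      (𝓝 (r / ((r : ℝ) + 1) - α * r * (1 / r.factorial))) := by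
    have h := tendsto_realChoose_linear_div_pow 1 (-(r + 1 : ℝ)) r
    simp only [one_mul, one_pow, ← sub_eq_add_neg] at h
    exact tendsto_const_nhds.sub (h.const_mul _)
  have hright : Tendsto (fun n : ℝ => r / (n / 2) -
      α * r * (realChoose (n - n / 2) r / n ^ r)) atTop
      (𝓝 (0 - α * r * ((1 / 2) ^ r / r.factorial))) := by
    have h := tendsto_realChoose_linear_div_pow (1 / 2) 0 r
    have h2 : ∀ n : ℝ, 1 / 2 * n + 0 = n - n / 2 := fun n => by ring
    simp only [h2] at h
    exact (tendsto_const_nhds.div_atTop (tendsto_id.atTop_div_const two_pos)).sub (h.const_mul _)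
  have hleft_neg : r / ((r : ℝ) + 1) - α * r * (1 / r.factorial) < 0 := by
    rw [div_lt_iff₀ (by positivity)] at hαr
    rw [sub_neg, mul_one_div, div_lt_div_iff₀ (by positivity) hf]
    nlinarith
  have hright_neg : 0 - α * r * ((1 / 2) ^ r / r.factorial) < 0 := by
    rw [zero_sub, neg_lt_zero]
    positivity
  obtain ⟨c, hc, hc0⟩ := exists_between (max_lt hleft_neg hright_neg)
  obtain ⟨hcl, hcr⟩ := max_lt_iff.1 hc
  obtain ⟨N, hN⟩ := eventually_atTop.1
    ((hleft.eventually_lt_const hcl).and (hright.eventually_lt_const hcr))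
  refine ⟨-c, by linarith, 1, one_pos, max N 1, by positivity, fun n hn x hx => ?_⟩
  obtain ⟨h1, h2⟩ := hN n ((le_max_left _ _).trans hn)
  have hn0 : 0 < n := one_pos.trans_le ((le_max_right _ _).trans hn)
  have hnr : (r : ℝ) + 1 ≤ n / 2 := hx.1.trans hx.2
  have hq : qr r α n x ≤ c := (qr_le_max hα.le hx).trans <| max_le
    ((qr_le hr1 hα.le (by linarith) (by linarith)).trans h1.le)
    ((qr_le hr1 hα.le (by linarith) (by linarith)).trans h2.le)
  have : 0 < 1 / n := by positivity
  linarith
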